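/- arXiv:1502.01692 — 2 statements merged into one kernel-verified Lean document; each statement's English description precedes it below -/
import Mathlib

section
/- Let t > 0 and let h : (0, ∞) → ℝ be a twice continuously differentiable solution of h''(r) + h'(r)/r = 8 t² r sinh(2 h(r)) for all r > 0. Define H_t : ℂ \ {0} → 2×2 hermitian matrices by H_t(z) = diag(|z|^{1/2} e^{h(|z|)}, |z|^{−1/2} e^{−h(|z|)}). Then H_t solves Hitchin's equation on ℂ \ {0}: for every z ≠ 0, ∂_z̄(H_t⁻¹ ∂_z H_t)(z) = t² [φ(z), H_t(z)⁻¹ φ(z)* H_t(z)]. -/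
open Matrix Complex

/-- Wirtinger derivative `∂_z f = (1/2)(∂f/∂x − i ∂f/∂y)` of `f : ℂ → ℂ`. -/
noncomputable def wd (f : ℂ → ℂ) (z : ℂ) : ℂ :=
  (1 / 2) * (fderiv ℝ f z 1 - Complex.I * fderiv ℝ f z Complex.I)

/-- Wirtinger derivative `∂_z̄ f = (1/2)(∂f/∂x + i ∂f/∂y)` of `f : ℂ → ℂ`. -/
noncomputable def wdbar (f : ℂ → ℂ) (z : ℂ) : ℂ :=
  (1 / 2) * (fderiv ℝ f z 1 + Complex.I * fderiv ℝ f z Complex.I)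

/-- Entrywise Wirtinger derivative `∂_z` of a matrix-valued function. -/
noncomputable def wdM (f : ℂ → Matrix (Fin 2) (Fin 2) ℂ) (z : ℂ) : Matrix (Fin 2) (Fin 2) ℂ :=
  Matrix.of fun i j => wd (fun w => f w i j) z

/-- Entrywise Wirtinger derivative `∂_z̄` of a matrix-valued function. -/
noncomputable def wdbarM (f : ℂ → Matrix (Fin 2) (Fin 2) ℂ) (z : ℂ) : Matrix (Fin 2) (Fin 2) ℂ :=
  Matrix.of fun i j => wdbar (fun w => f w i j) z

noncomputable def phi (z : ℂ) : Matrix (Fin 2) (Fin 2) ℂ := !![0, 1; z, 0]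

/-- The `H`-adjoint of a matrix `m`: `H⁻¹ mᴴ H`. -/
noncomputable def adjH (H m : Matrix (Fin 2) (Fin 2) ℂ) : Matrix (Fin 2) (Fin 2) ℂ :=
  H⁻¹ * mᴴ * H

/-- Matrix commutator. -/
noncomputable def mcomm {n : ℕ} (a b : Matrix (Fin n) (Fin n) ℂ) : Matrix (Fin n) (Fin n) ℂ :=
  a * b - b * a

theorem HasFDerivAt.wd_eq {f : ℂ → ℂ} {L : ℂ →L[ℝ] ℂ} {z : ℂ} (hf : HasFDerivAt f L z) :
    wd f z = (1 / 2) * (L 1 - Complex.I * L Complex.I) := by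
  rw [wd, hf.fderiv]

theorem HasFDerivAt.wdbar_eq {f : ℂ → ℂ} {L : ℂ →L[ℝ] ℂ} {z : ℂ} (hf : HasFDerivAt f L z) :
    wdbar f z = (1 / 2) * (L 1 + Complex.I * L Complex.I) := by
  rw [wdbar, hf.fderiv]

theorem Filter.EventuallyEq.wdbar_eq {f g : ℂ → ℂ} {z : ℂ} (hfg : f =ᶠ[nhds z] g) :
    wdbar f z = wdbar g z := by
  rw [wdbar, wdbar, hfg.fderiv_eq]

theorem wd_const (c z : ℂ) : wd (fun _ => c) z = 0 := by simp [wd]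

theorem wdbar_const (c z : ℂ) : wdbar (fun _ => c) z = 0 := by simp [wdbar]

theorem Complex.hasFDerivAt_norm {z : ℂ} (hz : z ≠ 0) :
    HasFDerivAt (fun w : ℂ => ‖w‖) (‖z‖⁻¹ • innerSL ℝ z) z := by
  have hn : ‖z‖ ≠ 0 := norm_ne_zero_iff.2 hz
  have h1 := (hasStrictFDerivAt_norm_sq (F := ℂ) z).hasFDerivAt.sqrt (pow_ne_zero 2 hn)
  simp only [Real.sqrt_sq (norm_nonneg _)] at h1
  refine h1.congr_fderiv ?_
  ext
  all_goals
    simp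
    field_simp

/-- The real differential of a radial function. -/
theorem hasFDerivAt_radial {g : ℝ → ℝ} {g' : ℝ} {z : ℂ} (hz : z ≠ 0)
    (hg : HasDerivAt g g' ‖z‖) :
    HasFDerivAt (fun w : ℂ => (g ‖w‖ : ℂ))
      (Complex.ofRealCLM.comp (g' • ‖z‖⁻¹ • innerSL ℝ z)) z :=
  Complex.ofRealCLM.hasFDerivAt.comp z (hg.comp_hasFDerivAt z (Complex.hasFDerivAt_norm hz))

theorem wd_radial {g : ℝ → ℝ} {g' : ℝ} {z : ℂ} (hz : z ≠ 0) (hg : HasDerivAt g g' ‖z‖) :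
    wd (fun w : ℂ => (g ‖w‖ : ℂ)) z = (starRingEnd ℂ) z * ((g' / (2 * ‖z‖) : ℝ) : ℂ) := by
  rw [(hasFDerivAt_radial hz hg).wd_eq]
  apply Complex.ext <;> simp [Complex.inner, -Complex.ofReal_div] <;> field_simp

theorem wdbar_conj_mul_radial {g : ℝ → ℝ} {g' : ℝ} {z : ℂ} (hz : z ≠ 0)
    (hg : HasDerivAt g g' ‖z‖) :
    wdbar (fun w : ℂ => (starRingEnd ℂ) w * (g ‖w‖ : ℂ)) z =
      ((g ‖z‖ + ‖z‖ * g' / 2 : ℝ) : ℂ) := by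
  have hc : HasFDerivAt (fun w : ℂ => (starRingEnd ℂ) w)
      (Complex.conjCLE : ℂ →L[ℝ] ℂ) z := Complex.conjCLE.hasFDerivAt
  have hn : ‖z‖ ≠ 0 := norm_ne_zero_iff.2 hz
  have hsq : z.re ^ 2 + z.im ^ 2 = ‖z‖ ^ 2 := by
    rw [Complex.sq_norm, Complex.normSq_apply]; ring
  rw [(hc.fun_mul (hasFDerivAt_radial hz hg)).wdbar_eq]
  apply Complex.ext
  · simp [Complex.inner]
    field_simp
    linear_combination g' * hsq
  · simp [Complex.inner]
    field_simp
    ring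

theorem hasDerivAt_rpow_mul_exp {h : ℝ → ℝ} {h' r : ℝ} (hr : 0 < r) (hh : HasDerivAt h h' r)
    (p s : ℝ) :
    HasDerivAt (fun x => x ^ p * Real.exp (s * h x))
      (r ^ p * Real.exp (s * h r) * (p / r + s * h')) r := by
  refine ((Real.hasDerivAt_rpow_const (p := p) (Or.inl hr.ne')).mul
    (hh.const_mul s).exp).congr_deriv ?_
  rw [Real.rpow_sub_one hr.ne']
  field_simp

theorem wdbar_inv_mul_wd_rpow_mul_exp {h : ℝ → ℝ} (hreg : ContDiffOn ℝ 2 h (Set.Ioi 0))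
    (s : ℝ) {z : ℂ} (hz : z ≠ 0) :
    wdbar (fun w => ((‖w‖ ^ (s / 2) * Real.exp (s * h ‖w‖) : ℝ) : ℂ)⁻¹ *
        wd (fun v => ((‖v‖ ^ (s / 2) * Real.exp (s * h ‖v‖) : ℝ) : ℂ)) w) z =
      ((s / 4 * (deriv (deriv h) ‖z‖ + deriv h ‖z‖ / ‖z‖) : ℝ) : ℂ) := by
  have hr : 0 < ‖z‖ := norm_pos_iff.2 hz
  have hd : ∀ r > 0, HasDerivAt h (deriv h r) r := fun r hr =>
    ((hreg.contDiffAt (Ioi_mem_nhds hr)).differentiableAt (by norm_num)).hasDerivAt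
  have hreg' : ContDiffOn ℝ 1 (deriv h) (Set.Ioi 0) :=
    ((contDiffOn_succ_iff_deriv_of_isOpen (n := 1) isOpen_Ioi).1
      (by simpa [one_add_one_eq_two] using hreg)).2.2
  have hd2 : HasDerivAt (deriv h) (deriv (deriv h) ‖z‖) ‖z‖ :=
    ((hreg'.contDiffAt (Ioi_mem_nhds hr)).differentiableAt (by norm_num)).hasDerivAt
  have key : (fun w : ℂ => ((‖w‖ ^ (s / 2) * Real.exp (s * h ‖w‖) : ℝ) : ℂ)⁻¹ *
        wd (fun v => ((‖v‖ ^ (s / 2) * Real.exp (s * h ‖v‖) : ℝ) : ℂ)) w) =ᶠ[nhds z]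
      fun w => (starRingEnd ℂ) w *
        (((fun r => (s / 2 / r + s * deriv h r) / (2 * r)) ‖w‖ : ℝ) : ℂ) := by
    filter_upwards [isOpen_ne.mem_nhds hz] with w hw
    have hw' : 0 < ‖w‖ := norm_pos_iff.2 hw
    rw [wd_radial (g := fun r => r ^ (s / 2) * Real.exp (s * h r)) hw
      (hasDerivAt_rpow_mul_exp hw' (hd _ hw') (s / 2) s), mul_left_comm, ← Complex.ofReal_inv,
      ← Complex.ofReal_mul]
    have hp : 0 < ‖w‖ ^ (s / 2) * Real.exp (s * h ‖w‖) := by positivity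
    rw [mul_div_assoc, inv_mul_cancel_left₀ hp.ne']
  have hG : HasDerivAt (fun r => (s / 2 / r + s * deriv h r) / (2 * r)) _ ‖z‖ :=
    (((hasDerivAt_const ‖z‖ (s / 2)).div (hasDerivAt_id _) hr.ne').add (hd2.const_mul s)).div
      ((hasDerivAt_id ‖z‖).const_mul 2) (by simpa using hr.ne')
  rw [key.wdbar_eq, wdbar_conj_mul_radial hz hG]
  congr 1
  simp
  field_simp
  ring

theorem inv_diag_fin_two {a d : ℂ} (ha : a ≠ 0) (hd : d ≠ 0) :
    (!![a, 0; 0, d] : Matrix (Fin 2) (Fin 2) ℂ)⁻¹ = !![a⁻¹, 0; 0, d⁻¹] := by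
  apply Matrix.inv_eq_right_inv
  simp [Matrix.one_fin_two, ha, hd]

theorem mcomm_phi_adjH_diag {a d : ℂ} (ha : a ≠ 0) (hd : d ≠ 0) (z : ℂ) :
    mcomm (phi z) (adjH !![a, 0; 0, d] (phi z)) =
      !![d⁻¹ * a - z * (starRingEnd ℂ) z * (a⁻¹ * d), 0;
         0, z * (starRingEnd ℂ) z * (a⁻¹ * d) - d⁻¹ * a] := by
  have hphi : (phi z)ᴴ = !![0, (starRingEnd ℂ) z; 1, 0] := by
    ext i j
    fin_cases i <;> fin_cases j <;> simp [phi]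
  rw [adjH, inv_diag_fin_two ha hd, hphi]
  ext i j
  fin_cases i <;> fin_cases j <;> simp [mcomm, phi] <;> ring

theorem wdbarM_inv_mul_wdM_diag {a d : ℂ → ℂ} {z : ℂ} (ha : ∀ᶠ w in nhds z, a w ≠ 0)
    (hd : ∀ᶠ w in nhds z, d w ≠ 0) :
    wdbarM (fun w => (!![a w, 0; 0, d w])⁻¹ * wdM (fun v => !![a v, 0; 0, d v]) w) z =
      !![wdbar (fun w => (a w)⁻¹ * wd a w) z, 0; 0, wdbar (fun w => (d w)⁻¹ * wd d w) z] := by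
  have key : ∀ i j, (fun w => ((!![a w, 0; 0, d w])⁻¹ * wdM (fun v => !![a v, 0; 0, d v]) w) i j)
      =ᶠ[nhds z] fun w => !![(a w)⁻¹ * wd a w, 0; 0, (d w)⁻¹ * wd d w] i j := by
    intro i j
    filter_upwards [ha, hd] with w haw hdw
    rw [inv_diag_fin_two haw hdw]
    fin_cases i <;> fin_cases j <;> simp [wdM, Matrix.mul_apply, wd_const]
  ext i j
  rw [wdbarM, Matrix.of_apply, (key i j).wdbar_eq]
  fin_cases i <;> fin_cases j <;> simp [wdbar_const]

theorem stmt11 (t : ℝ) (ht : 0 < t)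
    (h : ℝ → ℝ) (hreg : ContDiffOn ℝ 2 h (Set.Ioi 0))
    (hODE : ∀ r > (0 : ℝ), deriv (deriv h) r + deriv h r / r
      = 8 * t ^ 2 * r * Real.sinh (2 * h r))
    (H : ℂ → Matrix (Fin 2) (Fin 2) ℂ)
    (hH : ∀ z : ℂ, H z =
      !![((‖z‖ ^ ((1 : ℝ) / 2) * Real.exp (h ‖z‖) : ℝ) : ℂ), 0;
         0, ((‖z‖ ^ (-(1 : ℝ) / 2) * Real.exp (-h ‖z‖) : ℝ) : ℂ)]) :
    ∀ z : ℂ, z ≠ 0 →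
      wdbarM (fun w => (H w)⁻¹ * wdM H w) z =
        ((t : ℂ) ^ 2) • mcomm (phi z) (adjH (H z) (phi z)) := by
  intro z hz
  obtain rfl : H = _ := funext hH
  have hr : 0 < ‖z‖ := norm_pos_iff.2 hz
  have ne (s : ℝ) (k : ℝ → ℝ) {w : ℂ} (hw : w ≠ 0) :
      ((‖w‖ ^ s * Real.exp (k ‖w‖) : ℝ) : ℂ) ≠ 0 := by
    have : 0 < ‖w‖ := norm_pos_iff.2 hw
    exact Complex.ofReal_ne_zero.2 (by positivity)
  have ev (s : ℝ) (k : ℝ → ℝ) :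
      ∀ᶠ w : ℂ in nhds z, ((‖w‖ ^ s * Real.exp (k ‖w‖) : ℝ) : ℂ) ≠ 0 := by
    filter_upwards [isOpen_ne.mem_nhds hz] with w hw using ne s k hw
  have h1 := wdbar_inv_mul_wd_rpow_mul_exp hreg 1 hz
  have h2 := wdbar_inv_mul_wd_rpow_mul_exp hreg (-1) hz
  rw [hODE _ hr] at h1 h2
  simp only [one_mul, neg_one_mul] at h1 h2
  rw [wdbarM_inv_mul_wdM_diag (ev _ h) (ev _ fun r => -h r), h1, h2,
    mcomm_phi_adjH_diag (ne _ h hz) (ne _ (fun r => -h r) hz), Complex.mul_conj']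
  have hhalf : ‖z‖ ^ ((1 : ℝ) / 2) * ‖z‖ ^ ((1 : ℝ) / 2) = ‖z‖ := by
    rw [← Real.rpow_add hr]; norm_num
  have hinv : ‖z‖ ^ (-(1 : ℝ) / 2) = (‖z‖ ^ ((1 : ℝ) / 2))⁻¹ := by
    rw [neg_div, Real.rpow_neg hr.le]
  have hexp : Real.exp (2 * h ‖z‖) = Real.exp (h ‖z‖) * Real.exp (h ‖z‖) := by
    rw [← Real.exp_add, two_mul]
  have hA : (‖z‖ ^ (-(1 : ℝ) / 2) * Real.exp (-h ‖z‖))⁻¹ *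
      (‖z‖ ^ ((1 : ℝ) / 2) * Real.exp (h ‖z‖)) = ‖z‖ * Real.exp (2 * h ‖z‖) := by
    rw [hinv, hexp, Real.exp_neg, ← mul_inv, inv_inv]
    linear_combination (Real.exp (h ‖z‖)) ^ 2 * hhalf
  have hB : ‖z‖ ^ 2 * ((‖z‖ ^ ((1 : ℝ) / 2) * Real.exp (h ‖z‖))⁻¹ *
      (‖z‖ ^ (-(1 : ℝ) / 2) * Real.exp (-h ‖z‖))) = ‖z‖ * Real.exp (-(2 * h ‖z‖)) := by
    have hab : (‖z‖ ^ ((1 : ℝ) / 2) * Real.exp (h ‖z‖))⁻¹ *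
        (‖z‖ ^ (-(1 : ℝ) / 2) * Real.exp (-h ‖z‖)) = (‖z‖ * Real.exp (2 * h ‖z‖))⁻¹ := by
      rw [← hA]; simp only [mul_inv, inv_inv]; ring
    rw [hab, Real.exp_neg]
    field_simp
  simp only [← Complex.ofReal_inv, ← Complex.ofReal_mul, ← Complex.ofReal_pow,
    ← Complex.ofReal_sub, hA, hB]
  ext i j
  fin_cases i <;> fin_cases j <;> simp [Real.sinh_eq, -Complex.ofReal_sinh] <;> ring
end

section
/- Let k ≥ 1 be an integer. Define on ℂ \ {0} the matrix-valued functions a_z(z) = (k/(8z)) diag(1, −1), a_z̄(z) = −(k/(8 conj(z))) diag(1, −1), and φ_∞(z) = [[0, |z|^{k/2}], [z^k |z|^{−k/2}, 0]]. Then for every z ≠ 0: (i) ∂_z a_z̄(z) − ∂_z̄ a_z(z) + [a_z(z), a_z̄(z)] = 0; (ii) [φ_∞(z), φ_∞(z)*] = 0, where φ_∞(z)* is the conjugate transpose; (iii) ∂_z̄ φ_∞(z) + [a_z̄(z), φ_∞(z)] = 0. -/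
open Matrix Complex

/-- The Wirtinger derivative `∂_z̄` vanishes on complex differentiable functions. -/
lemma wdbar_eq_zero_of_differentiableAt {f : ℂ → ℂ} {z : ℂ} (hf : DifferentiableAt ℂ f z) :
    wdbar f z = 0 := by
  have h : fderiv ℝ f z Complex.I = Complex.I * fderiv ℝ f z 1 := by
    rw [hf.fderiv_restrictScalars ℝ]
    have h := (fderiv ℂ f z).map_smul Complex.I 1
    rwa [smul_eq_mul, smul_eq_mul, mul_one] at h
  rw [wdbar, h]
  linear_combination (1 / 2) * fderiv ℝ f z 1 * Complex.I_mul_I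

/-- The Wirtinger derivative `∂_z` vanishes on functions of `z̄` that are complex differentiable
in `z̄`. -/
lemma wd_comp_conj_eq_zero {f : ℂ → ℂ} {z : ℂ}
    (hf : DifferentiableAt ℂ f ((starRingEnd ℂ) z)) :
    wd (fun w => f ((starRingEnd ℂ) w)) z = 0 := by
  have hd := (hf.hasFDerivAt.restrictScalars ℝ).comp z
    (Complex.conjCLE : ℂ →L[ℝ] ℂ).hasFDerivAt
  have h : HasFDerivAt (fun w => f ((starRingEnd ℂ) w)) _ z := hd
  have hI := (fderiv ℂ f ((starRingEnd ℂ) z)).map_smul (-Complex.I) 1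
  simp only [smul_eq_mul, mul_one] at hI
  rw [wd, h.fderiv]
  simp only [ContinuousLinearMap.comp_apply, ContinuousLinearMap.coe_restrictScalars',
    ContinuousLinearEquiv.coe_coe, Complex.conjCLE_apply, map_one, Complex.conj_I, hI]
  linear_combination (1 / 2) * fderiv ℂ f ((starRingEnd ℂ) z) 1 * Complex.I_mul_I

/-- Leibniz rule for `∂_z̄` when the first factor is complex differentiable. -/
lemma wdbar_mul_of_differentiableAt {f g : ℂ → ℂ} {z : ℂ} (hf : DifferentiableAt ℂ f z)
    (hg : DifferentiableAt ℝ g z) :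
    wdbar (fun w => f w * g w) z = f z * wdbar g z := by
  have h0 := wdbar_eq_zero_of_differentiableAt hf
  rw [wdbar] at h0
  rw [wdbar, wdbar, fderiv_fun_mul (hf.restrictScalars ℝ) hg]
  simp only [_root_.add_apply, _root_.smul_apply, smul_eq_mul]
  linear_combination g z * h0

/-- The real derivative of `z ↦ ‖z‖ ^ p` away from the origin. -/
lemma hasFDerivAt_ofReal_norm_rpow (p : ℝ) {z : ℂ} (hz : z ≠ 0) :
    HasFDerivAt (fun w : ℂ => ((‖w‖ ^ p : ℝ) : ℂ))
      (Complex.ofRealCLM.comp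
        ((p / 2 * (‖z‖ ^ 2) ^ (p / 2 - 1)) • ((2 : ℕ) • innerSL ℝ z))) z := by
  have h1 : HasFDerivAt (fun w : ℂ => ‖w‖ ^ 2) ((2 : ℕ) • innerSL ℝ z) z :=
    (hasStrictFDerivAt_norm_sq z).hasFDerivAt
  have h2 := h1.rpow_const (p := p / 2) (Or.inl (by positivity))
  have h3 : (fun w : ℂ => (‖w‖ ^ 2) ^ (p / 2)) = fun w : ℂ => ‖w‖ ^ p := by
    funext w
    rw [← Real.rpow_natCast, ← Real.rpow_mul (norm_nonneg w)]
    congr 1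
    push_cast
    ring
  rw [h3] at h2
  exact Complex.ofRealCLM.hasFDerivAt.comp z h2

/-- `∂_z̄ |z| ^ p = p |z| ^ p / (2 z̄)` away from the origin. -/
lemma wdbar_norm_rpow (p : ℝ) {z : ℂ} (hz : z ≠ 0) :
    wdbar (fun w : ℂ => ((‖w‖ ^ p : ℝ) : ℂ)) z =
      p / (2 * (starRingEnd ℂ) z) * ((‖z‖ ^ p : ℝ) : ℂ) := by
  have hn : 0 < ‖z‖ := norm_pos_iff.mpr hz
  have hc : (starRingEnd ℂ) z ≠ 0 := (map_ne_zero _).mpr hz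
  have hp : (‖z‖ ^ 2) ^ (p / 2 - 1) = ‖z‖ ^ p / ‖z‖ ^ 2 := by
    rw [Real.rpow_sub_one (by positivity), ← Real.rpow_natCast, ← Real.rpow_mul hn.le]
    congr 2
    push_cast
    ring
  have hnz : ((‖z‖ : ℝ) : ℂ) ≠ 0 := by exact_mod_cast hn.ne'
  have hs : z * (starRingEnd ℂ) z = ((‖z‖ : ℝ) : ℂ) ^ 2 := Complex.mul_conj' z
  have hre : (z.re : ℂ) + Complex.I * z.im = z := by
    rw [mul_comm]; exact Complex.re_add_im z
  rw [wdbar, (hasFDerivAt_ofReal_norm_rpow p hz).fderiv, hp]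
  simp only [ContinuousLinearMap.comp_apply, _root_.smul_apply, innerSL_apply_apply,
    Complex.inner, Complex.ofRealCLM_apply, smul_eq_mul, nsmul_eq_mul, Complex.conj_re,
    Complex.mul_re, Complex.conj_im, Complex.I_re, Complex.I_im]
  push_cast
  field_simp
  simp
  linear_combination p * ((‖z‖ ^ p : ℝ) : ℂ) * ((starRingEnd ℂ) z * hre + hs)

theorem stmt13 (k : ℕ) (hk : 1 ≤ k) (az azbar phiInf : ℂ → Matrix (Fin 2) (Fin 2) ℂ)
    (haz : ∀ z : ℂ, az z = ((k : ℂ) / (8 * z)) • (!![1, 0; 0, -1] : Matrix (Fin 2) (Fin 2) ℂ))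
    (hazbar : ∀ z : ℂ, azbar z =
      (-((k : ℂ) / (8 * (starRingEnd ℂ) z))) • (!![1, 0; 0, -1] : Matrix (Fin 2) (Fin 2) ℂ))
    (hphi : ∀ z : ℂ, phiInf z =
      !![0, ((‖z‖ ^ ((k : ℝ) / 2) : ℝ) : ℂ);
         z ^ k * ((‖z‖ ^ (-((k : ℝ) / 2)) : ℝ) : ℂ), 0]) :
    ∀ z : ℂ, z ≠ 0 →
      wdM azbar z - wdbarM az z + mcomm (az z) (azbar z) = 0 ∧
      mcomm (phiInf z) (phiInf z)ᴴ = 0 ∧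
      wdbarM phiInf z + mcomm (azbar z) (phiInf z) = 0 := by
  intro z hz
  have hc : (starRingEnd ℂ) z ≠ 0 := (map_ne_zero _).mpr hz
  have hn : 0 < ‖z‖ := norm_pos_iff.mpr hz
  have hz8 : DifferentiableAt ℂ (fun w : ℂ => (k : ℂ) / (8 * w)) z := by
    fun_prop (disch := simpa using hz)
  have hz8' : DifferentiableAt ℂ (fun w : ℂ => (k : ℂ) / (8 * w)) ((starRingEnd ℂ) z) := by
    fun_prop (disch := simpa using hz)
  refine ⟨?_, ?_, ?_⟩
  · have hA : wdM azbar z = 0 := by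
      ext i j
      have h : (fun w => azbar w i j) = fun w => (fun v : ℂ => -((k : ℂ) / (8 * v)) *
          (!![1, 0; 0, -1] : Matrix (Fin 2) (Fin 2) ℂ) i j) ((starRingEnd ℂ) w) := by
        funext w
        rw [hazbar, Matrix.smul_apply, smul_eq_mul]
      rw [wdM, Matrix.of_apply, h]
      exact wd_comp_conj_eq_zero (hz8'.neg.mul_const _)
    have hB : wdbarM az z = 0 := by
      ext i j
      have h : (fun w => az w i j) = fun w => (k : ℂ) / (8 * w) *
          (!![1, 0; 0, -1] : Matrix (Fin 2) (Fin 2) ℂ) i j := by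
        funext w
        rw [haz, Matrix.smul_apply, smul_eq_mul]
      rw [wdbarM, Matrix.of_apply, h]
      exact wdbar_eq_zero_of_differentiableAt (hz8.mul_const _)
    rw [hA, hB, mcomm, haz, hazbar, Matrix.smul_mul, Matrix.smul_mul, Matrix.mul_smul,
      Matrix.mul_smul, smul_comm, sub_self, sub_self, add_zero]
  · have hs : z * (starRingEnd ℂ) z = ((‖z‖ : ℝ) : ℂ) ^ 2 := Complex.mul_conj' z
    have hr : ‖z‖ ^ k * ‖z‖ ^ (-((k : ℝ) / 2)) = ‖z‖ ^ ((k : ℝ) / 2) := by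
      rw [← Real.rpow_natCast, ← Real.rpow_add hn]
      congr 1
      ring
    have hrc : ((‖z‖ : ℝ) : ℂ) ^ k * ((‖z‖ ^ (-((k : ℝ) / 2)) : ℝ) : ℂ) =
        ((‖z‖ ^ ((k : ℝ) / 2) : ℝ) : ℂ) := by
      exact_mod_cast hr
    have hk2 : z ^ k * (starRingEnd ℂ) z ^ k = (((‖z‖ : ℝ) : ℂ) ^ k) ^ 2 := by
      rw [← mul_pow, hs, ← pow_mul, ← pow_mul, mul_comm]
    rw [mcomm, hphi, ← hrc]
    generalize ((‖z‖ ^ (-((k : ℝ) / 2)) : ℝ) : ℂ) = r at *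
    ext i j
    fin_cases i <;> fin_cases j <;>
      simp [Matrix.mul_apply, Matrix.vecMul, dotProduct, Fin.sum_univ_two]
    · linear_combination -r * (starRingEnd ℂ) r * hk2
    · linear_combination r * (starRingEnd ℂ) r * hk2
  · have h1 : wdbar (fun w => phiInf w 0 0) z = 0 := by
      simp [hphi, wdbar]
    have h2 : wdbar (fun w => phiInf w 1 1) z = 0 := by
      simp [hphi, wdbar]
    have h3 : wdbar (fun w => phiInf w 0 1) z =
        k / (4 * (starRingEnd ℂ) z) * ((‖z‖ ^ ((k : ℝ) / 2) : ℝ) : ℂ) := by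
      have h : (fun w => phiInf w 0 1) = fun w : ℂ => ((‖w‖ ^ ((k : ℝ) / 2) : ℝ) : ℂ) := by
        funext w
        simp [hphi]
      rw [h, wdbar_norm_rpow _ hz]
      push_cast
      field_simp
      ring
    have h4 : wdbar (fun w => phiInf w 1 0) z =
        -(k / (4 * (starRingEnd ℂ) z)) * (z ^ k * ((‖z‖ ^ (-((k : ℝ) / 2)) : ℝ) : ℂ)) := by
      have h : (fun w => phiInf w 1 0) =
          fun w : ℂ => w ^ k * ((‖w‖ ^ (-((k : ℝ) / 2)) : ℝ) : ℂ) := by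
        funext w
        simp [hphi]
      rw [h, wdbar_mul_of_differentiableAt (by fun_prop)
        (hasFDerivAt_ofReal_norm_rpow _ hz).differentiableAt, wdbar_norm_rpow _ hz]
      push_cast
      field_simp
      ring
    rw [mcomm, hazbar]
    ext i j
    fin_cases i <;> fin_cases j <;>
      simp only [wdbarM, Matrix.add_apply, Matrix.of_apply, Fin.zero_eta, Fin.mk_one, h1, h2, h3, h4]
    all_goals simp [hphi]
    all_goals field_simp
    all_goals ring
end
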